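/- Type covering lemma: fix finite nonempty alphabets 𝒴 and 𝒳̂. For every ε > 0 there exists N such that for all n ≥ N and every joint type Q_{YX̂} of denominator n on 𝒴×𝒳̂ (i.e., a pmf all of whose values are integer multiples of 1/n), there exists a set A ⊆ T_n(Q_{X̂}) with |A| ≤ 2^{n(I_Q(Y;X̂)+ε)} such that for every y^n ∈ T_n(Q_Y) there is some x̂^n ∈ A whose joint empirical distribution with y^n equals Q_{YX̂}. -/

import Mathlib

open scoped BigOperators Classical
open Finset

noncomputable section

/-- `p` is a probability mass function on the finite alphabet `α`. -/
def IsPMF {α : Type*} [Fintype α] (p : α → ℝ) : Prop :=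
  (∀ a, 0 ≤ p a) ∧ ∑ a, p a = 1

/-- `w` is a channel (a conditional pmf) from `α` to `β`. -/
def IsChannel {α β : Type*} [Fintype α] [Fintype β] (w : α → β → ℝ) : Prop :=
  ∀ a, IsPMF (w a)

/-- Kullback–Leibler divergence, base-2 logarithms, with the convention `0·log(0/q)=0`. -/
def klDiv {α : Type*} [Fintype α] (q p : α → ℝ) : ℝ :=
  ∑ a, q a * Real.logb 2 (q a / p a)

/-- Shannon entropy, base-2 logarithms. -/
def entropy {α : Type*} [Fintype α] (q : α → ℝ) : ℝ :=
  -∑ a, q a * Real.logb 2 (q a)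

/-- Mutual information of a joint pmf on `α × β`, base-2 logarithms. -/
def mutInfo {α β : Type*} [Fintype α] [Fintype β] (q : α × β → ℝ) : ℝ :=
  ∑ a, ∑ b, q (a, b) * Real.logb 2
    (q (a, b) / ((∑ b', q (a, b')) * (∑ a', q (a', b))))

/-- Conditional mutual information `I(X;Z|Y)` of a joint pmf on `X × Y × Z`,
base-2 logarithms. -/
def condMutInfo {α β γ : Type*} [Fintype α] [Fintype β] [Fintype γ]
    (q : α × β × γ → ℝ) : ℝ :=
  ∑ x, ∑ y, ∑ z, q (x, y, z) * Real.logb 2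
    ((q (x, y, z) * (∑ x', ∑ z', q (x', y, z'))) /
      ((∑ z', q (x, y, z')) * (∑ x', q (x', y, z))))

/-- Joint pmf `Q_{XYẐ} = Q_{XY}·Q_{Ẑ|XY}` built from `Q_{XY}` and a channel `W = Q_{Ẑ|XY}`. -/
def jointQ {α β γ : Type*} (Q : α × β → ℝ) (W : α × β → γ → ℝ) : α × β × γ → ℝ :=
  fun p => Q (p.1, p.2.1) * W (p.1, p.2.1) p.2.2

/-- The `(Y, Ẑ)`-marginal of `jointQ Q W`. -/
def margYZ {α β γ : Type*} [Fintype α] (Q : α × β → ℝ) (W : α × β → γ → ℝ) :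
    β × γ → ℝ :=
  fun p => ∑ x, Q (x, p.1) * W (x, p.1) p.2

/-- Expected distortion `E_Q[d(X, X̂)]` under the joint pmf `jointQ Q W`. -/
def expDist {α β γ : Type*} [Fintype α] [Fintype β] [Fintype γ]
    (Q : α × β → ℝ) (W : α × β → γ → ℝ) (d : α × γ → ℝ) : ℝ :=
  ∑ x, ∑ y, ∑ z, Q (x, y) * W (x, y) z * d (x, z)

/-- `E(Q_{XY}, R, Δ)`: min over channels `Q_{X̂|XY}` with `E_Q[d(X,X̂)] ≤ Δ` of
`I_Q(X;X̂|Y) + |I_Q(Y;X̂) − R|⁺`. -/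
def innerE {α β γ : Type*} [Fintype α] [Fintype β] [Fintype γ]
    (Q : α × β → ℝ) (d : α × γ → ℝ) (R Δ : ℝ) : ℝ :=
  sInf { e | ∃ W : α × β → γ → ℝ, IsChannel W ∧ expDist Q W d ≤ Δ ∧
    e = condMutInfo (jointQ Q W) + max (mutInfo (margYZ Q W) - R) 0 }

/-- `E(R, Δ)`: min over pmfs `Q_{XY}` of `D(Q_{XY}‖P_{XY}) + E(Q_{XY},R,Δ)`. -/
def Eexp {α β γ : Type*} [Fintype α] [Fintype β] [Fintype γ]
    (P : α × β → ℝ) (d : α × γ → ℝ) (R Δ : ℝ) : ℝ :=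
  sInf { e | ∃ Q : α × β → ℝ, IsPMF Q ∧ e = klDiv Q P + innerE Q d R Δ }

/-- `Δ_min`: min over functions `x̂ : 𝒴 → 𝒳̂` of `E[d(X, x̂(Y))]`. -/
def Dmin {α β γ : Type*} [Fintype α] [Fintype β] [Fintype γ]
    (P : α × β → ℝ) (d : α × γ → ℝ) : ℝ :=
  sInf { e | ∃ φ : β → γ, e = ∑ x, ∑ y, P (x, y) * d (x, φ y) }

/-- The number of messages `⌊2^{nR}⌋` for a blocklength-`n` code of rate `R`. -/
def codeSize (R : ℝ) (n : ℕ) : ℕ := ⌊(2 : ℝ) ^ ((n : ℝ) * R)⌋₊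

/-- The probability `P{d̄(X^n, g(f(Y^n))) ≤ Δ}` under the i.i.d. law `P_{XY}^n`. -/
def probSuccess {α β γ : Type*} [Fintype α] [Fintype β] [Fintype γ]
    (P : α × β → ℝ) (d : α × γ → ℝ) (Δ : ℝ) {n M : ℕ}
    (f : (Fin n → β) → Fin M) (g : Fin M → Fin n → γ) : ℝ :=
  ∑ x : Fin n → α, ∑ y : Fin n → β,
    if (1 / (n : ℝ)) * ∑ i, d (x i, g (f y) i) ≤ Δ then ∏ i, P (x i, y i) else 0

/-- `p_c(n, R, Δ)`: the maximal correct-reconstruction probability over all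
blocklength-`n` codes of rate `R`. -/
def pc {α β γ : Type*} [Fintype α] [Fintype β] [Fintype γ]
    (P : α × β → ℝ) (d : α × γ → ℝ) (R Δ : ℝ) (n : ℕ) : ℝ :=
  sSup { p | ∃ f : (Fin n → β) → Fin (codeSize R n),
    ∃ g : Fin (codeSize R n) → Fin n → γ, p = probSuccess P d Δ f g }

/-- Conditional rate-distortion function `R_c(Q_{XY}, Δ)`. -/
def Rc {α β γ : Type*} [Fintype α] [Fintype β] [Fintype γ]
    (Q : α × β → ℝ) (d : α × γ → ℝ) (Δ : ℝ) : ℝ :=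
  sInf { r | ∃ W : α × β → γ → ℝ, IsChannel W ∧ expDist Q W d ≤ Δ ∧
    r = condMutInfo (jointQ Q W) }

/-- Remote rate-distortion function `R_r(P_{XY}, Δ)`. -/
def Rr {α β γ : Type*} [Fintype α] [Fintype β] [Fintype γ]
    (P : α × β → ℝ) (d : α × γ → ℝ) (Δ : ℝ) : ℝ :=
  sInf { r | ∃ W : β → γ → ℝ, IsChannel W ∧
    (∑ x, ∑ y, ∑ z, P (x, y) * W y z * d (x, z)) ≤ Δ ∧
    r = mutInfo (fun p : β × γ => (∑ x, P (x, p.1)) * W p.1 p.2) }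

/-- Empirical distribution (type) of a sequence. -/
def empDist {α : Type*} {n : ℕ} (y : Fin n → α) : α → ℝ :=
  fun a => ((Finset.univ.filter fun i => y i = a).card : ℝ) / n

/-- Joint empirical distribution (joint type) of a pair of sequences. -/
def empDist2 {α β : Type*} {n : ℕ} (y : Fin n → α) (z : Fin n → β) : α × β → ℝ :=
  fun p => ((Finset.univ.filter fun i => y i = p.1 ∧ z i = p.2).card : ℝ) / n

end

/-- The number of occurrences of the letter `c` in the finite family `f`. -/
noncomputable def letterCount {ι γ : Type*} [Fintype ι] (f : ι → γ) (c : γ) : ℕ :=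
  (univ.filter fun i => f i = c).card

/-- The families with the same letter counts as `f`. -/
noncomputable def sameType {ι γ : Type*} [Fintype ι] [Fintype γ] (f : ι → γ) : Finset (ι → γ) :=
  univ.filter fun g => ∀ c, letterCount g c = letterCount f c

theorem mem_sameType {ι γ : Type*} [Fintype ι] [Fintype γ] {f g : ι → γ} :
    g ∈ sameType f ↔ ∀ c, letterCount g c = letterCount f c := by
  simp [sameType]

theorem letterCount_comp_perm {ι γ : Type*} [Fintype ι] (f : ι → γ) (σ : Equiv.Perm ι) (c : γ) :
    letterCount (f ∘ σ) c = letterCount f c :=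
  card_equiv σ (by simp)

theorem exists_perm_of_letterCount_eq {ι γ : Type*} [Fintype ι] {f g : ι → γ}
    (h : ∀ c, letterCount g c = letterCount f c) : ∃ σ : Equiv.Perm ι, g = f ∘ σ := by
  have e : ∀ c, {a // g a = c} ≃ {b // f b = c} := fun c =>
    Fintype.equivOfCardEq (by
      simpa only [letterCount, Fintype.card_subtype] using h c)
  exact ⟨Equiv.ofFiberEquiv e, funext fun a => (Equiv.ofFiberEquiv_map e a).symm⟩

theorem sum_letterCount {ι γ : Type*} [Fintype ι] [Fintype γ] (f : ι → γ) :
    ∑ c, letterCount f c = Fintype.card ι := by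
  simpa [letterCount] using
    (card_eq_sum_card_fiberwise (f := f) (s := univ) (t := univ) (by simp)).symm

/-- The size of a type class is a multinomial coefficient. -/
theorem card_sameType_mul_prod_factorial {ι γ : Type*} [Fintype ι] [Fintype γ] (f : ι → γ) :
    (sameType f).card * ∏ c, (letterCount f c).factorial = (Fintype.card ι).factorial := by
  have hfib : ∀ g ∈ sameType f,
      (univ.filter fun σ : Equiv.Perm ι => f ∘ σ = g).card =
        ∏ c, (letterCount f c).factorial := by
    intro g hg
    obtain ⟨τ, rfl⟩ := exists_perm_of_letterCount_eq (mem_sameType.1 hg)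
    have hstab := DomMulAct.stabilizer_card f
    simp only [Fintype.card_subtype] at hstab
    simp only [letterCount]
    rw [← hstab]
    refine card_equiv (Equiv.mulRight τ⁻¹) fun σ => ?_
    simp only [mem_filter, mem_univ, true_and, Equiv.coe_mulRight, funext_iff, Function.comp_apply,
      Equiv.Perm.coe_mul]
    constructor
    · intro h i
      simpa using h (τ⁻¹ i)
    · intro h i
      simpa using h (τ i)
  rw [← Fintype.card_perm, ← card_univ,
    card_eq_sum_card_fiberwise (f := fun σ : Equiv.Perm ι => f ∘ σ) (t := sameType f),
    sum_congr rfl hfib, sum_const, smul_eq_mul]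
  intro σ _
  exact mem_sameType.2 (letterCount_comp_perm f σ)

theorem exists_letterCount_eq {γ : Type*} [Fintype γ] {n : ℕ} (k : γ → ℕ) (hk : ∑ c, k c = n) :
    ∃ f : Fin n → γ, ∀ c, letterCount f c = k c := by
  have e : Fin n ≃ Σ c, Fin (k c) := Fintype.equivOfCardEq (by simp [hk])
  refine ⟨fun i => (e i).1, fun c => ?_⟩
  have e' : {i // (e i).1 = c} ≃ Fin (k c) :=
    (e.subtypeEquiv (q := fun x => x.1 = c) fun _ => Iff.rfl).trans
      (Equiv.sigmaSubtype c)
  simpa [letterCount, Fintype.card_subtype] using Fintype.card_congr e'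

theorem letterCount_fst {ι α β : Type*} [Fintype ι] [Fintype β] (w : ι → α × β) (a : α) :
    letterCount (fun i => (w i).1) a = ∑ b, letterCount w (a, b) := by
  rw [letterCount, card_eq_sum_card_fiberwise (f := fun i => (w i).2) (t := univ) (by simp)]
  simp only [letterCount, filter_filter, Prod.ext_iff]

theorem letterCount_snd {ι α β : Type*} [Fintype ι] [Fintype α] (w : ι → α × β) (b : β) :
    letterCount (fun i => (w i).2) b = ∑ a, letterCount w (a, b) := by
  rw [letterCount, card_eq_sum_card_fiberwise (f := fun i => (w i).1) (t := univ) (by simp)]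
  simp only [letterCount, filter_filter, Prod.ext_iff, and_comm]

/-- All sequences in the type class of the first component have equally many partners in the
joint type class. -/
theorem card_sameType_fst_mul_card_partners {ι α β : Type*} [Fintype ι] [Fintype α] [Fintype β]
    (w : ι → α × β) {y : ι → α} (hy : y ∈ sameType fun i => (w i).1) :
    (sameType fun i => (w i).1).card *
      ((sameType fun i => (w i).2).filter fun z => (fun i => (y i, z i)) ∈ sameType w).card =
      (sameType w).card := by
  have hfib : ∀ y' ∈ sameType (fun i => (w i).1),
      ((sameType w).filter fun v => (fun i => (v i).1) = y').card =
      ((sameType fun i => (w i).2).filter fun z => (fun i => (y i, z i)) ∈ sameType w).card := by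
    intro y' hy'
    obtain ⟨σ, rfl⟩ := exists_perm_of_letterCount_eq (f := y') (g := y) fun c =>
      (mem_sameType.1 hy c).trans (mem_sameType.1 hy' c).symm
    refine card_nbij' (fun v i => (v (σ i)).2) (fun z i => (y' i, z (σ.symm i))) ?_ ?_ ?_ ?_
    · intro v hv
      simp only [coe_filter, Set.mem_ofPred_eq] at hv ⊢
      obtain ⟨hv, rfl⟩ := hv
      have h := fun c => (letterCount_comp_perm v σ c).trans (mem_sameType.1 hv c)
      refine ⟨mem_sameType.2 fun c => ?_, mem_sameType.2 h⟩
      rw [letterCount_snd w, ← sum_congr rfl fun a _ => h (a, c), ← letterCount_snd]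
      rfl
    · intro z hz
      simp only [coe_filter, Set.mem_ofPred_eq, and_true] at hz ⊢
      refine mem_sameType.2 fun c => ?_
      rw [← mem_sameType.1 hz.2 c, ← letterCount_comp_perm _ σ]
      congr 1
      funext i
      simp
    · intro v hv
      simp only [coe_filter, Set.mem_ofPred_eq] at hv
      obtain ⟨hv, rfl⟩ := hv
      simp
    · intro z hz
      simp
  rw [card_eq_sum_card_fiberwise (s := sameType w) (f := fun v i => (v i).1)
    (t := sameType fun i => (w i).1), sum_congr rfl hfib, sum_const, smul_eq_mul]
  intro v hv
  refine mem_sameType.2 fun a => ?_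
  rw [letterCount_fst, letterCount_fst]
  exact sum_congr rfl fun b _ => mem_sameType.1 hv _

theorem exists_subset_card_uncovered_le {α β : Type*} (S : Finset α) {T : Finset β}
    (hT : T.Nonempty) (r : α → β → Prop) {q : ℝ} (hq : q ≤ 1)
    (h : ∀ y ∈ S, q * T.card ≤ (T.filter (r y)).card) (m : ℕ) :
    ∃ A ⊆ T, A.card ≤ m ∧
      ((S.filter fun y => ∀ z ∈ A, ¬ r y z).card : ℝ) ≤ (1 - q) ^ m * S.card := by
  induction m with
  | zero => exact ⟨∅, by simp, by simp, by simp⟩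
  | succ m ih =>
    obtain ⟨A, hAT, hAm, hA⟩ := ih
    set U := S.filter fun y => ∀ z ∈ A, ¬ r y z with hU
    obtain ⟨z, hzT, hz⟩ : ∃ z ∈ T, q * U.card ≤ (U.filter fun y => r y z).card := by
      refine exists_le_of_sum_le hT ?_
      have hdc : ∑ y ∈ U, (T.filter (r y)).card = ∑ z ∈ T, (U.filter fun y => r y z).card :=
        sum_card_bipartiteAbove_eq_sum_card_bipartiteBelow r
      rw [← Nat.cast_sum, ← hdc, Nat.cast_sum]
      calc ∑ _z ∈ T, q * (U.card : ℝ) = ∑ _y ∈ U, q * (T.card : ℝ) := by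
            simp only [sum_const, nsmul_eq_mul]; ring
        _ ≤ _ := sum_le_sum fun y hy => h y (mem_of_mem_filter y hy)
    refine ⟨insert z A, insert_subset hzT hAT, (card_insert_le _ _).trans (by omega), ?_⟩
    have hsplit : (U.filter fun y => r y z).card +
        (S.filter fun y => ∀ z' ∈ insert z A, ¬ r y z').card = U.card := by
      rw [← card_filter_add_card_filter_not (s := U) fun y => r y z]
      congr 2
      ext y
      simp only [hU, mem_filter, mem_insert, forall_eq_or_imp]
      tauto
    have hsplit' : ((U.filter fun y => r y z).card : ℝ) +
        (S.filter fun y => ∀ z' ∈ insert z A, ¬ r y z').card = U.card := by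
      exact_mod_cast hsplit
    have := mul_le_mul_of_nonneg_left hA (sub_nonneg.2 hq)
    rw [pow_succ]
    linarith

/-- Greedy covering: if every point of `S` is related to a fraction at least `q` of `T`, then
about `log |S| / q` points of `T` suffice to cover `S`. -/
theorem exists_cover_of_card_filter_ge {α β : Type*} (S : Finset α) {T : Finset β}
    (hT : T.Nonempty) (r : α → β → Prop) {q : ℝ} (hq0 : 0 < q) (hq : q ≤ 1)
    (h : ∀ y ∈ S, q * T.card ≤ (T.filter (r y)).card) {L : ℝ} (hL : 0 ≤ L)
    (hS : (S.card : ℝ) ≤ Real.exp L) :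
    ∃ A ⊆ T, (A.card : ℝ) ≤ (L + 2) / q ∧ ∀ y ∈ S, ∃ z ∈ A, r y z := by
  obtain ⟨A, hAT, hAm, hA⟩ :=
    exists_subset_card_uncovered_le S hT r hq h ⌈(L + 1) / q⌉₊
  refine ⟨A, hAT, ?_, ?_⟩
  · have h1 : ((A.card : ℕ) : ℝ) ≤ ⌈(L + 1) / q⌉₊ := by exact_mod_cast hAm
    have h2 := Nat.ceil_lt_add_one (show 0 ≤ (L + 1) / q by positivity)
    have h3 : 1 ≤ 1 / q := (one_le_div hq0).2 hq
    have h4 : (L + 2) / q = (L + 1) / q + 1 / q := by ring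
    linarith
  · have hlt : (1 - q) ^ ⌈(L + 1) / q⌉₊ * (S.card : ℝ) < 1 := by
      have h1 : (1 - q) ^ ⌈(L + 1) / q⌉₊ ≤ Real.exp (-(L + 1)) := by
        calc (1 - q) ^ ⌈(L + 1) / q⌉₊ ≤ Real.exp (-q) ^ ⌈(L + 1) / q⌉₊ :=
              pow_le_pow_left₀ (sub_nonneg.2 hq) (Real.one_sub_le_exp_neg q) _
          _ = Real.exp (⌈(L + 1) / q⌉₊ * -q) := (Real.exp_nat_mul _ _).symm
          _ ≤ _ := by
              have := (div_le_iff₀ hq0).1 (Nat.le_ceil ((L + 1) / q))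
              exact Real.exp_le_exp.2 (by linarith)
      calc _ ≤ Real.exp (-(L + 1)) * Real.exp L :=
            mul_le_mul h1 hS (by positivity) (by positivity)
        _ = Real.exp (-1) := by rw [← Real.exp_add]; ring_nf
        _ < 1 := by simp
    have h0 : (S.filter fun y => ∀ z ∈ A, ¬ r y z).card = 0 := by
      exact_mod_cast Nat.lt_one_iff.1 (by exact_mod_cast hA.trans_lt hlt)
    intro y hy
    by_contra! hcon
    exact (filter_eq_empty_iff.1 (card_eq_zero.1 h0)) hy hcon

theorem mul_log_sub_le_log_factorial (m : ℕ) :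
    m * Real.log m - m ≤ Real.log m.factorial := by
  rcases Nat.eq_zero_or_pos m with rfl | hm
  · simp
  have hm' : (0 : ℝ) < m := by exact_mod_cast hm
  have h := Real.log_le_log (by positivity) (Real.pow_div_factorial_le_exp _ hm'.le m)
  rw [Real.log_exp, Real.log_div (by positivity) (by positivity), Real.log_pow] at h
  linarith

theorem log_factorial_le (m : ℕ) :
    Real.log m.factorial ≤ 1 + Real.log (m + 1) + (m * Real.log m - m) := by
  rcases m with _ | m
  · simp
  have hmain : Real.log (m + 1).factorial ≤
      1 + Real.log (m + 1) + ((m + 1) * Real.log (m + 1) - (m + 1)) := by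
    induction m with
    | zero => simp
    | succ m ih =>
      have h := Real.one_sub_inv_le_log_of_pos (x := ((m : ℝ) + 1 + 1) / (m + 1)) (by positivity)
      have h2 : 1 - (((m : ℝ) + 1 + 1) / (m + 1))⁻¹ = 1 / (m + 1 + 1) := by
        field_simp
        ring
      rw [Real.log_div (by positivity) (by positivity), h2, div_le_iff₀ (by positivity)] at h
      rw [Nat.factorial_succ, Nat.cast_mul, Real.log_mul (by positivity) (by positivity)]
      push_cast
      linarith
  have hmono : Real.log (m + 1) ≤ Real.log (m + 1 + 1) :=
    Real.log_le_log (by positivity) (by linarith)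
  push_cast
  linarith

theorem log_card_sameType {ι γ : Type*} [Fintype ι] [Fintype γ] (f : ι → γ) :
    Real.log (sameType f).card =
      Real.log (Fintype.card ι).factorial - ∑ c, Real.log (letterCount f c).factorial := by
  have hpos : 0 < (sameType f).card := card_pos.2 ⟨f, mem_sameType.2 fun _ => rfl⟩
  rw [← card_sameType_mul_prod_factorial f, Nat.cast_mul, Nat.cast_prod,
    Real.log_mul (by positivity) (by positivity), Real.log_prod fun c _ => by positivity]
  ring

theorem sum_mul_log_sub_le_sum_log_factorial {γ : Type*} [Fintype γ] {n : ℕ} (f : Fin n → γ) :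
    ∑ c, (letterCount f c : ℝ) * Real.log (letterCount f c) - n ≤
      ∑ c, Real.log (letterCount f c).factorial := by
  have hcast : (n : ℝ) = ∑ c, (letterCount f c : ℝ) := by
    exact_mod_cast (by simpa using (sum_letterCount f).symm)
  rw [hcast, ← sum_sub_distrib]
  exact sum_le_sum fun c _ => mul_log_sub_le_log_factorial _

theorem mul_mutInfo_mul_log_two {α β : Type*} [Fintype α] [Fintype β] {n : ℕ} (hn : 0 < n)
    (k : α × β → ℕ) (hk : ∑ p, k p = n) :
    n * mutInfo (fun p => (k p : ℝ) / n) * Real.log 2 =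
      n * Real.log n + ∑ p, (k p : ℝ) * Real.log (k p)
        - ∑ a, ((∑ b, k (a, b) : ℕ) : ℝ) * Real.log (∑ b, k (a, b) : ℕ)
        - ∑ b, ((∑ a, k (a, b) : ℕ) : ℝ) * Real.log (∑ a, k (a, b) : ℕ) := by
  have hn' : (n : ℝ) ≠ 0 := by positivity
  have hl2 : Real.log 2 ≠ 0 := by positivity
  have hterm : ∀ a b, n * ((k (a, b) : ℝ) / n * Real.logb 2 ((k (a, b) : ℝ) / n /
      ((∑ b', (k (a, b') : ℝ) / n) * (∑ a', (k (a', b) : ℝ) / n)))) * Real.log 2 =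
      k (a, b) * Real.log n + k (a, b) * Real.log (k (a, b))
        - k (a, b) * Real.log (∑ b, k (a, b) : ℕ) - k (a, b) * Real.log (∑ a, k (a, b) : ℕ) := by
    intro a b
    rcases Nat.eq_zero_or_pos (k (a, b)) with h0 | hpos
    · simp [h0]
    have hA : 0 < ∑ b, k (a, b) := hpos.trans_le
      (single_le_sum (f := fun b => k (a, b)) (fun _ _ => Nat.zero_le _) (mem_univ b))
    have hB : 0 < ∑ a, k (a, b) := hpos.trans_le
      (single_le_sum (f := fun a => k (a, b)) (fun _ _ => Nat.zero_le _) (mem_univ a))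
    simp only [← sum_div, ← Nat.cast_sum, Real.logb]
    rw [Real.log_div (by positivity) (by positivity), Real.log_mul (by positivity) (by positivity),
      Real.log_div (by positivity) (by positivity), Real.log_div (by positivity) (by positivity),
      Real.log_div (by positivity) (by positivity)]
    field_simp
    ring
  have hB : ∑ b, ((∑ a, k (a, b) : ℕ) : ℝ) * Real.log (∑ a, k (a, b) : ℕ) =
      ∑ a, ∑ b, (k (a, b) : ℝ) * Real.log (∑ a, k (a, b) : ℕ) := by
    rw [sum_comm]
    exact sum_congr rfl fun b _ => by rw [Nat.cast_sum, sum_mul]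
  have hA : ∑ a, ((∑ b, k (a, b) : ℕ) : ℝ) * Real.log (∑ b, k (a, b) : ℕ) =
      ∑ a, ∑ b, (k (a, b) : ℝ) * Real.log (∑ b, k (a, b) : ℕ) :=
    sum_congr rfl fun a _ => by rw [Nat.cast_sum, sum_mul]
  have hN : (n : ℝ) * Real.log n = ∑ a, ∑ b, (k (a, b) : ℝ) * Real.log n := by
    simp only [← sum_mul]
    rw [← Fintype.sum_prod_type fun p => (k p : ℝ), ← Nat.cast_sum, hk]
  rw [hA, hB, hN, Fintype.sum_prod_type, mutInfo, mul_sum, sum_mul]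
  simp only [← sum_add_distrib, ← sum_sub_distrib]
  refine sum_congr rfl fun a _ => ?_
  rw [mul_sum, sum_mul]
  exact sum_congr rfl fun b _ => hterm a b

/-- The product of the sizes of the marginal type classes exceeds the size of the joint type class
by a factor at most `2 ^ (n I)`, up to a polynomial in `n`. -/
theorem log_card_marginals_sub_log_card_joint_le {α β : Type*} [Fintype α] [Fintype β] {n : ℕ}
    (hn : 0 < n) (w : Fin n → α × β) :
    Real.log (sameType fun i => (w i).1).card + Real.log (sameType fun i => (w i).2).card
        - Real.log (sameType w).card ≤
      (1 + Fintype.card (α × β)) * (1 + Real.log (n + 1)) +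
        n * mutInfo (fun p => (letterCount w p : ℝ) / n) * Real.log 2 := by
  have hsum : ∑ p, letterCount w p = n := by simpa using sum_letterCount w
  rw [mul_mutInfo_mul_log_two hn _ hsum]
  simp only [log_card_sameType, Fintype.card_fin, ← letterCount_fst, ← letterCount_snd]
  have hn1 := log_factorial_le n
  have hw : ∑ p, Real.log (letterCount w p).factorial ≤
      Fintype.card (α × β) * (1 + Real.log (n + 1)) +
        (∑ p, (letterCount w p : ℝ) * Real.log (letterCount w p) - n) := by
    have hcast : (n : ℝ) = ∑ p, (letterCount w p : ℝ) := by exact_mod_cast hsum.symm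
    calc _ ≤ ∑ p, ((1 + Real.log (n + 1)) +
          ((letterCount w p : ℝ) * Real.log (letterCount w p) - letterCount w p)) := by
          refine sum_le_sum fun p _ => (log_factorial_le _).trans ?_
          have hle : letterCount w p ≤ n :=
            (single_le_sum (f := letterCount w) (fun _ _ => Nat.zero_le _) (mem_univ p)).trans_eq
              hsum
          gcongr
      _ = _ := by
          rw [sum_add_distrib, sum_sub_distrib, ← hcast, sum_const, nsmul_eq_mul, card_univ]
  have hy := sum_mul_log_sub_le_sum_log_factorial fun i => (w i).1
  have hz := sum_mul_log_sub_le_sum_log_factorial fun i => (w i).2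
  linarith

theorem eventually_polynomial_le_two_rpow (s c : ℕ) {ε : ℝ} (hε : 0 < ε) :
    ∃ N : ℕ, ∀ n : ℕ, N ≤ n →
      (n * Real.log s + 2) * Real.exp ((1 + c) * (1 + Real.log (n + 1))) ≤ 2 ^ (n * ε) := by
  set r : ℝ := 2 ^ (-ε) with hr
  have hr0 : 0 < r := by positivity
  have hr1 : |r| < 1 := by
    rw [abs_of_pos hr0]
    exact Real.rpow_lt_one_of_one_lt_of_neg one_lt_two (neg_neg_of_pos hε)
  set C : ℝ := (s + 2) * Real.exp 1 ^ (1 + c) with hC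
  have hC0 : 0 < C := by positivity
  obtain ⟨N, hN⟩ := Filter.eventually_atTop.1
    ((tendsto_pow_const_mul_const_pow_of_abs_lt_one (c + 2) hr1).eventually_le_const
      (show 0 < r / C by positivity))
  refine ⟨N, fun n hn => ?_⟩
  have h := hN (n + 1) (hn.trans n.le_succ)
  rw [le_div_iff₀ hC0, pow_succ r] at h
  push_cast at h
  have h1 : C * ((n : ℝ) + 1) ^ (c + 2) * r ^ n ≤ 1 :=
    le_of_mul_le_mul_right (by linarith) hr0
  have h2 : (2 : ℝ) ^ (n * ε) = 1 / r ^ n := by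
    rw [hr, ← Real.rpow_mul_natCast zero_le_two, one_div, ← Real.rpow_neg zero_le_two]
    ring_nf
  have h3 : Real.exp ((1 + c) * (1 + Real.log (n + 1))) = (Real.exp 1 * (n + 1)) ^ (1 + c) := by
    rw [← Real.exp_log (show (0 : ℝ) < n + 1 by positivity), ← Real.exp_add, ← Real.exp_nat_mul,
      Real.exp_log (by positivity)]
    push_cast
    rfl
  have h4 : n * Real.log s + 2 ≤ (s + 2) * ((n : ℝ) + 1) := by
    have hlog : Real.log s ≤ s := Real.log_le_self s.cast_nonneg
    have := mul_le_mul_of_nonneg_left hlog (Nat.cast_nonneg (α := ℝ) n)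
    nlinarith [Nat.cast_nonneg (α := ℝ) n, Nat.cast_nonneg (α := ℝ) s]
  rw [h2, le_div_iff₀ (by positivity), h3]
  refine le_trans (mul_le_mul_of_nonneg_right ?_ (by positivity)) h1
  calc _ ≤ ((s + 2) * ((n : ℝ) + 1)) * (Real.exp 1 * (n + 1)) ^ (1 + c) := by gcongr
    _ = _ := by rw [hC, mul_pow]; ring

/-- **Type covering lemma**: for every `ε > 0` there is `N` such that for all `n ≥ N`
and every joint type `Q_{YX̂}` of denominator `n`, there is a subset `A` of the type
class of `Q_{X̂}` with `|A| ≤ 2^{n(I_Q(Y;X̂)+ε)}` covering the type class of `Q_Y`: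
every `y^n` of type `Q_Y` forms joint type `Q_{YX̂}` with some `x̂^n ∈ A`. -/
theorem type_covering_lemma
    (𝒴 𝒵 : Type) [Fintype 𝒴] [Fintype 𝒵] [Nonempty 𝒴] [Nonempty 𝒵] :
    ∀ ε : ℝ, 0 < ε → ∃ N : ℕ, ∀ n : ℕ, N ≤ n →
      ∀ Q : 𝒴 × 𝒵 → ℝ, IsPMF Q → (∀ p, ∃ k : ℕ, Q p = (k : ℝ) / n) →
        ∃ A : Finset (Fin n → 𝒵),
          (∀ z ∈ A, empDist z = fun b => ∑ a, Q (a, b)) ∧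
          (A.card : ℝ) ≤ 2 ^ ((n : ℝ) * (mutInfo Q + ε)) ∧
          ∀ y : Fin n → 𝒴, (empDist y = fun a => ∑ b, Q (a, b)) →
            ∃ z ∈ A, empDist2 y z = Q := by
  intro ε hε
  obtain ⟨N, hN⟩ :=
    eventually_polynomial_le_two_rpow (Fintype.card 𝒴) (Fintype.card (𝒴 × 𝒵)) hε
  refine ⟨max N 1, fun n hn Q hQ hk => ?_⟩
  have hn0 : 0 < n := (le_max_right N 1).trans hn
  have hn' : (0 : ℝ) < n := by exact_mod_cast hn0
  choose k hk using hk
  have hksum : ∑ p, k p = n := by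
    have h := hQ.2
    simp only [hk, ← sum_div, ← Nat.cast_sum] at h
    exact_mod_cast (div_eq_one_iff_eq hn'.ne').1 h
  obtain ⟨w, hw⟩ := exists_letterCount_eq k hksum
  have hQw : Q = fun p => (letterCount w p : ℝ) / n := funext fun p => by rw [hk, hw]
  have hQ1 : ∀ a, ∑ b, Q (a, b) = (letterCount (fun i => (w i).1) a : ℝ) / n := fun a => by
    rw [letterCount_fst, Nat.cast_sum, sum_div, hQw]
  have hQ2 : ∀ b, ∑ a, Q (a, b) = (letterCount (fun i => (w i).2) b : ℝ) / n := fun b => by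
    rw [letterCount_snd, Nat.cast_sum, sum_div, hQw]
  set S := sameType fun i => (w i).1 with hS
  set T := sameType fun i => (w i).2 with hT
  have hSpos : 0 < S.card := card_pos.2 ⟨_, mem_sameType.2 fun _ => rfl⟩
  have hTne : T.Nonempty := ⟨_, mem_sameType.2 fun _ => rfl⟩
  have hTpos : 0 < T.card := card_pos.2 hTne
  have hPpos : 0 < (sameType w).card := card_pos.2 ⟨_, mem_sameType.2 fun _ => rfl⟩
  set q : ℝ := (sameType w).card / (S.card * T.card) with hq
  have hq0 : 0 < q := by positivity
  have hdeg : ∀ y ∈ S, q * T.card =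
      (T.filter fun z => (fun i => (y i, z i)) ∈ sameType w).card := by
    intro y hy
    rw [hq, ← card_sameType_fst_mul_card_partners w hy]
    push_cast
    rw [← hS, ← hT]
    field_simp
  have hq1 : q ≤ 1 := by
    have h := hdeg _ (mem_sameType.2 fun _ => rfl)
    have h2 : ((T.filter fun z => (fun i => ((w i).1, z i)) ∈ sameType w).card : ℝ) ≤ T.card := by
      exact_mod_cast card_filter_le _ _
    rw [← h] at h2
    exact (mul_le_iff_le_one_left (by positivity)).1 h2
  have hSle : (S.card : ℝ) ≤ Real.exp (n * Real.log (Fintype.card 𝒴)) := by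
    rw [Real.exp_nat_mul, Real.exp_log (by exact_mod_cast Fintype.card_pos)]
    have h : S.card ≤ Fintype.card (Fin n → 𝒴) := card_le_univ S
    rw [Fintype.card_fun, Fintype.card_fin] at h
    exact_mod_cast h
  have hL : 0 ≤ n * Real.log (Fintype.card 𝒴) := by positivity
  obtain ⟨A, hAT, hAcard, hA⟩ := exists_cover_of_card_filter_ge S hTne
    (fun y z => (fun i => (y i, z i)) ∈ sameType w) hq0 hq1 (fun y hy => (hdeg y hy).le.trans_eq (by congr)) hL hSle
  refine ⟨A, fun z hz => ?_, hAcard.trans ?_, fun y hy => ?_⟩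
  · funext b
    rw [hQ2, ← mem_sameType.1 (hAT hz) b]
    rfl
  · have hqinv : 1 / q ≤ Real.exp ((1 + Fintype.card (𝒴 × 𝒵)) * (1 + Real.log (n + 1))) *
        2 ^ (n * mutInfo Q) := by
      rw [Real.rpow_def_of_pos two_pos, ← Real.exp_add, ← Real.log_le_iff_le_exp (by positivity),
        hq, one_div_div, Real.log_div (by positivity) (by positivity),
        Real.log_mul (by positivity) (by positivity)]
      have h := log_card_marginals_sub_log_card_joint_le hn0 w
      rw [← hQw] at h
      linarith
    calc _ = (n * Real.log (Fintype.card 𝒴) + 2) * (1 / q) := by ring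
      _ ≤ _ := mul_le_mul_of_nonneg_left hqinv (by positivity)
      _ = _ := (mul_assoc _ _ _).symm
      _ ≤ 2 ^ (n * ε) * 2 ^ (n * mutInfo Q) :=
        mul_le_mul_of_nonneg_right (hN n ((le_max_left N 1).trans hn)) (by positivity)
      _ = _ := by rw [← Real.rpow_add two_pos]; ring_nf
  · have hyS : y ∈ S := mem_sameType.2 fun a => by
      have h := congrFun hy a
      rw [hQ1] at h
      have h2 : (letterCount y a : ℝ) / n = letterCount (fun i => (w i).1) a / n := h
      rw [div_left_inj' hn'.ne'] at h2
      exact_mod_cast h2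
    obtain ⟨z, hzA, hz⟩ := hA y hyS
    refine ⟨z, hzA, funext fun p => ?_⟩
    simp only [hQw, empDist2]
    rw [← mem_sameType.1 hz p]
    simp only [letterCount, Prod.ext_iff]
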